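/- arXiv:math/9811100 — 2 statements merged into one kernel-verified Lean document; each statement's English description precedes it below -/
import Mathlib

section
/- Let n ≥ 2 and set r = n−1. For a positive integer m, the following two conditions are equivalent: (1) every invertible totally nonnegative n×n real matrix x is oscillatory if and only if x^m is totally positive; (2) for every permutation (i_1, …, i_r) of the indices 1, …, r, the word obtained by concatenating m copies of (i_1, …, i_r) contains, as a (not necessarily contiguous) subsequence, a reduced word for the longest element w₀ of the symmetric group S_n. -/
/-- A square real matrix is totally nonnegative if every minor (determinant of a
square submatrix selected by strictly increasing row and column indices) is nonnegative. -/
def TotallyNonneg {n : ℕ} (x : Matrix (Fin n) (Fin n) ℝ) : Prop :=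
  ∀ (k : ℕ) (f g : Fin k → Fin n), StrictMono f → StrictMono g →
    0 ≤ (x.submatrix f g).det

/-- A square real matrix is totally positive if every minor is positive. -/
def TotallyPos {n : ℕ} (x : Matrix (Fin n) (Fin n) ℝ) : Prop :=
  ∀ (k : ℕ) (f g : Fin k → Fin n), StrictMono f → StrictMono g →
    0 < (x.submatrix f g).det

/-- A matrix is oscillatory if some positive integer power of it is totally positive. -/
def Oscillatory {n : ℕ} (x : Matrix (Fin n) (Fin n) ℝ) : Prop :=
  ∃ m : ℕ, 0 < m ∧ TotallyPos (x ^ m)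

/-- The adjacent transposition `s_{k+1} = (k+1, k+2)` of `S_n` (0-indexed: it swaps
positions `k` and `k+1`), for a letter `k : Fin (n-1)`. -/
def adjTransposition (n : ℕ) (k : Fin (n - 1)) : Equiv.Perm (Fin n) :=
  Equiv.swap ⟨k.val, by have := k.isLt; omega⟩ ⟨k.val + 1, by have := k.isLt; omega⟩

/-- A word in the letters `{1,…,n-1}` (encoded as `Fin (n-1)`) is a reduced word for the
longest element `w₀` of `S_n` (the reversal permutation) if the product of the
corresponding adjacent transpositions is `w₀` and its length is `ℓ(w₀) = n(n-1)/2`. -/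
def IsReducedWordW0 (n : ℕ) (l : List (Fin (n - 1))) : Prop :=
  (l.map (adjTransposition n)).prod = (Fin.revPerm : Equiv.Perm (Fin n)) ∧
    l.length = n * (n - 1) / 2

open Matrix Finset

section CauchyBinet

variable {n k : ℕ}

lemma det_mul_eq_sum_prod_det {R : Type*} [CommRing R] (P : Matrix (Fin k) (Fin n) R)
    (Q : Matrix (Fin n) (Fin k) R) :
    (P * Q).det = ∑ p : Fin k → Fin n, (∏ i, P i (p i)) * (Q.submatrix p id).det := by
  have h : P * Q = fun i => ∑ j, P i j • Q j := by
    ext i c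
    simp [Matrix.mul_apply]
  change Matrix.detRowAlternating (P * Q) = _
  rw [h]
  change (Matrix.detRowAlternating (n := Fin k) (R := R)).toMultilinearMap _ = _
  rw [MultilinearMap.map_sum]
  refine Finset.sum_congr rfl fun p _ => ?_
  rw [MultilinearMap.map_smul_univ]
  rfl

lemma factorial_mul_det_mul {R : Type*} [CommRing R] (P : Matrix (Fin k) (Fin n) R)
    (Q : Matrix (Fin n) (Fin k) R) :
    (k.factorial : R) * (P * Q).det =
      ∑ p : Fin k → Fin n, (P.submatrix id p).det * (Q.submatrix p id).det := by
  have key : ∀ π : Equiv.Perm (Fin k), (P * Q).det =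
      ∑ p : Fin k → Fin n,
        (Equiv.Perm.sign π : R) * (∏ i, P i (p (π i))) * (Q.submatrix p id).det := by
    intro π
    rw [det_mul_eq_sum_prod_det, ← Equiv.sum_comp (Equiv.arrowCongr π.symm (Equiv.refl _))]
    refine Finset.sum_congr rfl fun p _ => ?_
    have h1 : (Q.submatrix (p ∘ π) id).det = (Equiv.Perm.sign π : R) * (Q.submatrix p id).det := by
      rw [← Matrix.det_permute π (Q.submatrix p id)]
      rfl
    have h2 : (Equiv.arrowCongr π.symm (Equiv.refl (Fin n))) p = p ∘ π := by
      ext; simp [Equiv.arrowCongr]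
    rw [h2, h1]
    simp only [Function.comp]
    ring
  have h3 : (k.factorial : R) * (P * Q).det = ∑ _π : Equiv.Perm (Fin k), (P * Q).det := by
    simp [Fintype.card_perm]
  rw [h3, Finset.sum_congr rfl fun π _ => key π, Finset.sum_comm]
  refine Finset.sum_congr rfl fun p _ => ?_
  rw [← Finset.sum_mul, ← Matrix.det_transpose (P.submatrix id p),
    Matrix.det_apply' (P.submatrix id p)ᵀ]
  rfl

lemma det_submatrix_mul_det_submatrix_nonneg {A B : Matrix (Fin n) (Fin n) ℝ}
    (hA : TotallyNonneg A) (hB : TotallyNonneg B) {f g : Fin k → Fin n} (hf : StrictMono f)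
    (hg : StrictMono g) (p : Fin k → Fin n) :
    0 ≤ (A.submatrix f p).det * (B.submatrix p g).det := by
  by_cases hp : Function.Injective p
  · set π := Tuple.sort p
    have hq : StrictMono (p ∘ π) :=
      (Tuple.monotone_sort p).strictMono_of_injective (hp.comp π.injective)
    have h1 : (A.submatrix f (p ∘ π)).det = (Equiv.Perm.sign π : ℝ) * (A.submatrix f p).det := by
      rw [← Matrix.det_permute' π (A.submatrix f p)]
      rfl
    have h2 : (B.submatrix (p ∘ π) g).det = (Equiv.Perm.sign π : ℝ) * (B.submatrix p g).det := by
      rw [← Matrix.det_permute π (B.submatrix p g)]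
      rfl
    have h := mul_nonneg (hA k f _ hf hq) (hB k _ g hq hg)
    rw [h1, h2] at h
    rcases Int.units_eq_one_or (Equiv.Perm.sign π) with e | e <;> simpa [e] using h
  · obtain ⟨i, j, hij, hne⟩ : ∃ i j, p i = p j ∧ i ≠ j := by
      simpa [Function.Injective] using hp
    rw [Matrix.det_zero_of_row_eq (M := B.submatrix p g) hne (by ext; simp [hij]), mul_zero]

lemma det_submatrix_mul_le {A B : Matrix (Fin n) (Fin n) ℝ} (hA : TotallyNonneg A)
    (hB : TotallyNonneg B) {f g : Fin k → Fin n} (hf : StrictMono f) (hg : StrictMono g)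
    (p : Fin k → Fin n) :
    (A.submatrix f p).det * (B.submatrix p g).det ≤
      (k.factorial : ℝ) * ((A * B).submatrix f g).det := by
  have h : (A * B).submatrix f g = A.submatrix f id * B.submatrix id g :=
    Matrix.submatrix_mul _ _ _ _ _ Function.bijective_id
  rw [h, factorial_mul_det_mul]
  exact Finset.single_le_sum
    (f := fun p => (A.submatrix f p).det * (B.submatrix p g).det)
    (fun q _ => det_submatrix_mul_det_submatrix_nonneg hA hB hf hg q) (Finset.mem_univ p)

lemma TotallyNonneg.det_submatrix_mul_pos {A B : Matrix (Fin n) (Fin n) ℝ}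
    (hA : TotallyNonneg A) (hB : TotallyNonneg B) {f g p : Fin k → Fin n} (hf : StrictMono f)
    (hg : StrictMono g) (h1 : 0 < (A.submatrix f p).det) (h2 : 0 < (B.submatrix p g).det) :
    0 < ((A * B).submatrix f g).det :=
  pos_of_mul_pos_right ((mul_pos h1 h2).trans_le (det_submatrix_mul_le hA hB hf hg p))
    (by positivity)

lemma TotallyNonneg.mul {A B : Matrix (Fin n) (Fin n) ℝ} (hA : TotallyNonneg A)
    (hB : TotallyNonneg B) : TotallyNonneg (A * B) := by
  intro k f g hf hg
  have h : (A * B).submatrix f g = A.submatrix f id * B.submatrix id g :=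
    Matrix.submatrix_mul _ _ _ _ _ Function.bijective_id
  have h0 : (0 : ℝ) < k.factorial := by positivity
  refine nonneg_of_mul_nonneg_right ?_ h0
  rw [h, factorial_mul_det_mul]
  exact Finset.sum_nonneg fun p _ => det_submatrix_mul_det_submatrix_nonneg hA hB hf hg p

end CauchyBinet

section Elementary

variable {n : ℕ}

lemma TotallyNonneg.transpose {A : Matrix (Fin n) (Fin n) ℝ} (hA : TotallyNonneg A) :
    TotallyNonneg Aᵀ := by
  intro k f g hf hg
  rw [← Matrix.det_transpose]
  exact hA k g f hg hf

lemma TotallyNonneg.apply_nonneg {A : Matrix (Fin n) (Fin n) ℝ} (hA : TotallyNonneg A)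
    (i j : Fin n) : 0 ≤ A i j := by
  simpa using hA 1 (fun _ => i) (fun _ => j) (Subsingleton.strictMono _) (Subsingleton.strictMono _)

lemma strictMono_vec_two {a b : Fin n} (h : a < b) : StrictMono ![a, b] := by
  intro i j hij
  fin_cases i <;> fin_cases j <;> simp_all

lemma TotallyNonneg.mul_le_mul {A : Matrix (Fin n) (Fin n) ℝ} (hA : TotallyNonneg A)
    {i j k l : Fin n} (hij : i < j) (hkl : k < l) : A i l * A j k ≤ A i k * A j l := by
  have h := hA 2 ![i, j] ![k, l] (strictMono_vec_two hij) (strictMono_vec_two hkl)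
  rw [Matrix.det_fin_two] at h
  simpa using h

lemma TotallyNonneg.submatrix {A : Matrix (Fin n) (Fin n) ℝ} (hA : TotallyNonneg A) {k : ℕ}
    {f g : Fin k → Fin n} (hf : StrictMono f) (hg : StrictMono g) :
    TotallyNonneg (A.submatrix f g) := by
  intro l p q hp hq
  rw [Matrix.submatrix_submatrix]
  exact hA l _ _ (hf.comp hp) (hg.comp hq)

lemma TotallyNonneg.submatrix_rev {A : Matrix (Fin n) (Fin n) ℝ} (hA : TotallyNonneg A) :
    TotallyNonneg (A.submatrix Fin.rev Fin.rev) := by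
  intro k f g hf hg
  have h := hA k (Fin.rev ∘ f ∘ Fin.rev) (Fin.rev ∘ g ∘ Fin.rev)
    (fun a b hab => Fin.rev_lt_rev.2 (hf (Fin.rev_lt_rev.2 hab)))
    (fun a b hab => Fin.rev_lt_rev.2 (hg (Fin.rev_lt_rev.2 hab)))
  rw [← Matrix.det_submatrix_equiv_self Fin.revPerm] at h
  convert h using 2
  ext i j
  simp

lemma totallyNonneg_of_bidiagonal {A : Matrix (Fin n) (Fin n) ℝ} (h0 : ∀ i j, 0 ≤ A i j)
    (h1 : ∀ i j, i < j → A i j = 0) (h2 : ∀ i j : Fin n, (j : ℕ) + 1 < i → A i j = 0) :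
    TotallyNonneg A := by
  intro k
  induction k with
  | zero => intro f g _ _; simp
  | succ k ih =>
    intro f g hf hg
    have hminor := ih (f ∘ Fin.succ) (g ∘ Fin.succ) (hf.comp (Fin.strictMono_succ))
      (hg.comp (Fin.strictMono_succ))
    have hdet : (A.submatrix f g).det =
        A (f 0) (g 0) * (A.submatrix (f ∘ Fin.succ) (g ∘ Fin.succ)).det := by
      rcases le_or_gt (f 0) (g 0) with h | h
      · rw [Matrix.det_succ_row_zero, Fin.sum_univ_succ, Finset.sum_eq_zero]
        · simp
        · intro j _
          have : A (f 0) (g j.succ) = 0 := h1 _ _ (h.trans_lt (hg (Fin.succ_pos j)))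
          simp [this]
      · rw [Matrix.det_succ_column_zero, Fin.sum_univ_succ, Finset.sum_eq_zero]
        · simp
        · intro j _
          have : A (f j.succ) (g 0) = 0 := by
            apply h2
            have h3 : f 0 < f j.succ := hf (Fin.succ_pos j)
            simp only [Fin.lt_def] at h h3
            omega
          simp [this]
    rw [hdet]
    exact mul_nonneg (h0 _ _) hminor

lemma TotallyNonneg.one : TotallyNonneg (1 : Matrix (Fin n) (Fin n) ℝ) := by
  refine totallyNonneg_of_bidiagonal (fun i j => ?_) (fun i j h => ?_) (fun i j h => ?_)
  · rw [Matrix.one_apply]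
    split_ifs <;> norm_num
  · exact Matrix.one_apply_ne h.ne
  · exact Matrix.one_apply_ne (by rintro rfl; omega)

lemma TotallyNonneg.pow {A : Matrix (Fin n) (Fin n) ℝ} (hA : TotallyNonneg A) (m : ℕ) :
    TotallyNonneg (A ^ m) := by
  induction m with
  | zero => simpa using TotallyNonneg.one
  | succ m ih => rw [pow_succ]; exact ih.mul hA

end Elementary

section PrincipalMinors

lemma det_eq_apply_zero_mul_det_schur {K : Type*} [Field K] {k : ℕ}
    (M : Matrix (Fin (k + 1)) (Fin (k + 1)) K) (h : M 0 0 ≠ 0) :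
    M.det = M 0 0 * (Matrix.of fun i j : Fin k =>
      M i.succ j.succ - M i.succ 0 / M 0 0 * M 0 j.succ).det := by
  set N : Matrix (Fin (k + 1)) (Fin (k + 1)) K :=
    Matrix.of fun i j => if i = 0 then M 0 j else M i j - M i 0 / M 0 0 * M 0 j with hN
  have h1 : M.det = N.det := by
    refine Matrix.det_eq_of_forall_row_eq_smul_add_const
      (fun i => if i = 0 then 0 else M i 0 / M 0 0) 0 (by simp) fun i j => ?_
    by_cases hi : i = 0 <;> simp [hN, hi]
  rw [h1, Matrix.det_succ_column_zero, Fin.sum_univ_succ, Finset.sum_eq_zero]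
  · simp only [hN, Fin.val_zero, pow_zero, Matrix.of_apply, one_mul, if_true, add_zero]
    congr 2
  · intro j _
    simp [hN, h]

lemma TotallyNonneg.apply_zero_pos {n : ℕ} {A : Matrix (Fin (n + 1)) (Fin (n + 1)) ℝ}
    (hA : TotallyNonneg A) (hdet : A.det ≠ 0) : 0 < A 0 0 := by
  refine lt_of_le_of_ne (hA.apply_nonneg 0 0) fun h0 => hdet ?_
  by_cases h : ∃ l, A 0 l ≠ 0
  · obtain ⟨l, hl⟩ := h
    have hl0 : 0 < l := Fin.pos_iff_ne_zero.2 (by rintro rfl; exact hl h0.symm)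
    refine Matrix.det_eq_zero_of_column_eq_zero 0 fun j => ?_
    rcases eq_or_ne j 0 with rfl | hj
    · exact h0.symm
    have h1 := hA.mul_le_mul (Fin.pos_iff_ne_zero.2 hj) hl0
    rw [← h0, zero_mul] at h1
    have h2 := (hA.apply_nonneg 0 l).lt_of_ne' hl
    have h3 := hA.apply_nonneg j 0
    nlinarith
  · push Not at h
    exact Matrix.det_eq_zero_of_row_eq_zero 0 h

lemma strictMono_cons_zero_succ {n k : ℕ} {f : Fin k → Fin n} (hf : StrictMono f) :
    StrictMono (Fin.cons 0 (Fin.succ ∘ f) : Fin (k + 1) → Fin (n + 1)) := by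
  intro i j hij
  induction j using Fin.cases with
  | zero => exact absurd hij (Fin.not_lt_zero i)
  | succ j =>
    induction i using Fin.cases with
    | zero => simp
    | succ i => simpa using hf (Fin.succ_lt_succ_iff.1 hij)

lemma exists_strictMono_eq_succ_comp {n k : ℕ} {f : Fin k → Fin (n + 1)} (hf : StrictMono f)
    (h : ∀ i, f i ≠ 0) : ∃ f' : Fin k → Fin n, StrictMono f' ∧ f = Fin.succ ∘ f' := by
  refine ⟨fun i => (f i).pred (h i), fun i j hij => ?_, ?_⟩
  · simpa using hf hij
  · ext i; simp

lemma TotallyNonneg.det_principal_pos {n : ℕ} {A : Matrix (Fin n) (Fin n) ℝ}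
    (hA : TotallyNonneg A) (hdet : A.det ≠ 0) {k : ℕ} {f : Fin k → Fin n} (hf : StrictMono f) :
    0 < (A.submatrix f f).det := by
  induction n generalizing k with
  | zero =>
    rcases k with _ | k
    · simp
    · exact (f 0).elim0
  | succ n ih =>
    have containing_zero : ∀ {A : Matrix (Fin (n + 1)) (Fin (n + 1)) ℝ}, TotallyNonneg A →
        A.det ≠ 0 → ∀ {k : ℕ} {f : Fin k → Fin n}, StrictMono f →
        0 < (A.submatrix (Fin.cons 0 (Fin.succ ∘ f) : Fin (k + 1) → Fin (n + 1))
          (Fin.cons 0 (Fin.succ ∘ f) : Fin (k + 1) → Fin (n + 1))).det := by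
      intro A hA hdet k f hf
      have h0 := hA.apply_zero_pos hdet
      set B : Matrix (Fin n) (Fin n) ℝ :=
        Matrix.of fun i j => A i.succ j.succ - A i.succ 0 / A 0 0 * A 0 j.succ with hB
      have hminor : ∀ (l : ℕ) (p q : Fin l → Fin n),
          (A.submatrix (Fin.cons 0 (Fin.succ ∘ p) : Fin (l + 1) → Fin (n + 1))
            (Fin.cons 0 (Fin.succ ∘ q) : Fin (l + 1) → Fin (n + 1))).det =
          A 0 0 * (B.submatrix p q).det := by
        intro l p q
        rw [det_eq_apply_zero_mul_det_schur _ (by simpa using h0.ne')]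
        rfl
      have hBT : TotallyNonneg B := by
        intro l p q hp hq
        refine nonneg_of_mul_nonneg_right ?_ h0
        rw [← hminor]
        exact hA _ _ _ (strictMono_cons_zero_succ hp) (strictMono_cons_zero_succ hq)
      have hBdet : B.det ≠ 0 := by
        rw [det_eq_apply_zero_mul_det_schur A h0.ne'] at hdet
        exact right_ne_zero_of_mul hdet
      rw [hminor]
      exact mul_pos h0 (ih hBT hBdet hf)
    by_cases hf0 : ∃ i, f i = 0
    · obtain ⟨i, hi⟩ := hf0
      rcases k with _ | k
      · exact i.elim0
      have hf00 : f 0 = 0 := Fin.le_zero_iff.1 (hi ▸ hf.monotone (Fin.zero_le i))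
      obtain ⟨f', hf', he⟩ := exists_strictMono_eq_succ_comp (f := f ∘ Fin.succ)
        (hf.comp Fin.strictMono_succ)
        (fun j h => absurd (hf (Fin.succ_pos j)) (by simp [hf00, show f j.succ = 0 from h]))
      have hcons : f = Fin.cons 0 (Fin.succ ∘ f') := by
        rw [← he, ← hf00]
        exact (Fin.cons_self_tail f).symm
      rw [hcons]
      exact containing_zero hA hdet hf'
    · push Not at hf0
      obtain ⟨f', hf', rfl⟩ := exists_strictMono_eq_succ_comp hf hf0
      rw [← Matrix.submatrix_submatrix]
      refine ih (hA.submatrix Fin.strictMono_succ Fin.strictMono_succ) ?_ hf'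
      rcases n with _ | n
      · simp
      have hrev : (A.submatrix Fin.rev Fin.rev).det ≠ 0 := by
        have := Matrix.det_submatrix_equiv_self Fin.revPerm A
        exact fun h => hdet (this ▸ h)
      have h := containing_zero hA.submatrix_rev hrev (f := Fin.castSucc)
        Fin.strictMono_castSucc
      rw [← Matrix.det_submatrix_equiv_self Fin.revPerm] at h
      convert h.ne' using 2
      ext i j
      have hcons : ∀ i : Fin (n + 1), i.succ = Fin.rev
          ((Fin.cons 0 (Fin.succ ∘ Fin.castSucc) : Fin (n + 1) → Fin (n + 2)) i.rev) := by
        intro i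
        obtain ⟨i, rfl⟩ := Fin.rev_surjective i
        rw [Fin.rev_rev]
        induction i using Fin.cases with
        | zero => ext; simp
        | succ i => ext; simp; omega
      simp only [Matrix.submatrix_apply, Fin.revPerm_apply]
      rw [← hcons, ← hcons]

end PrincipalMinors

section Plucker

lemma det_mul_det_updateCol_updateCol {R : Type*} [CommRing R] {ι : Type*} [Fintype ι]
    [DecidableEq ι] (M : Matrix ι ι R) {i j : ι} (hij : i ≠ j) (v q : ι → R) :
    M.det * ((M.updateCol j q).updateCol i v).det =
      (M.updateCol i v).det * (M.updateCol j q).det +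
        (M.updateCol j v).det * ((M.updateCol j q).updateCol i (M.col j)).det := by
  have h : M.det • v = ∑ l, (M.updateCol l v).det • M.col l := by
    rw [← Matrix.mulVec_cramer]
    ext a
    simp [Matrix.mulVec, dotProduct, Matrix.cramer_apply, mul_comm]
  have h2 := congrArg (fun w => Matrix.cramer (M.updateCol j q) w i) h
  simp only [map_smul, map_sum, Pi.smul_apply, Finset.sum_apply, smul_eq_mul] at h2
  simp only [Matrix.cramer_apply] at h2
  rw [h2, ← Finset.sum_subset (Finset.subset_univ {i, j}), Finset.sum_pair hij]
  · congr 2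
    congr 1
    ext a b
    by_cases hb : b = i
    · subst hb; simp [hij]
    · simp [Matrix.updateCol_apply, hb]
  · intro l _ hl
    simp only [Finset.mem_insert, Finset.mem_singleton, not_or] at hl
    rw [Matrix.det_zero_of_column_eq (M := (M.updateCol j q).updateCol i (M.col l)) (Ne.symm hl.1),
      mul_zero]
    intro a
    simp [hl]

lemma det_updateCol_single {R : Type*} [CommRing R] {k : ℕ}
    (M : Matrix (Fin (k + 1)) (Fin (k + 1)) R) (i a : Fin (k + 1)) :
    (M.updateCol i (Pi.single a 1)).det =
      (-1) ^ (a + i : ℕ) * (M.submatrix a.succAbove i.succAbove).det := by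
  rw [← Matrix.adjugate_fin_succ_eq_det_submatrix, ← Matrix.cramer_apply,
    ← Matrix.transpose_apply (adjugate M), Matrix.adjugate_transpose, Matrix.adjugate_def,
    Matrix.transpose_transpose, Matrix.of_apply]

lemma updateCol_submatrix_right {R m n l p : Type*} [DecidableEq p] (A : Matrix m n R) (f : l → m)
    (g : p → n) (j : p) (q : n) :
    (A.submatrix f g).updateCol j (fun a => A (f a) q) =
      A.submatrix f (Function.update g j q) := by
  ext a b
  by_cases hb : b = j
  · subst hb; simp
  · simp [hb]

/-- A three-term Plücker relation among the minors of a matrix. -/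
lemma det_mul_det_minor {R : Type*} [CommRing R] {n k : ℕ}
    (A : Matrix (Fin n) (Fin n) R) (f g : Fin (k + 1) → Fin n) {i j : Fin (k + 1)} (hij : i ≠ j)
    (p : Fin n) (a : Fin (k + 1)) :
    (A.submatrix f g).det *
        (A.submatrix (f ∘ a.succAbove) (Function.update g j p ∘ i.succAbove)).det =
      (A.submatrix f (Function.update g j p)).det *
          (A.submatrix (f ∘ a.succAbove) (g ∘ i.succAbove)).det +
        (A.submatrix f (Function.update g i p)).det *
          (A.submatrix (f ∘ a.succAbove) (Function.update g j (g i) ∘ i.succAbove)).det := by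
  have h := det_mul_det_updateCol_updateCol (A.submatrix f g) hij.symm
    (fun b => A (f b) p) (Pi.single a 1)
  have hb : (A.submatrix f g).col i = fun b => A (f b) (g i) := rfl
  rw [hb, Matrix.updateCol_comm _ hij, Matrix.updateCol_comm _ hij, det_updateCol_single,
    det_updateCol_single, det_updateCol_single] at h
  simp only [updateCol_submatrix_right, Matrix.submatrix_submatrix] at h
  have hs : ((-1 : R) ^ (a + i : ℕ)) * (-1) ^ (a + i : ℕ) = 1 := by
    rw [← mul_pow]; simp
  linear_combination (-1 : R) ^ (a + i : ℕ) * h - (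
    (A.submatrix f g).det *
        (A.submatrix (f ∘ a.succAbove) (Function.update g j p ∘ i.succAbove)).det -
      (A.submatrix f (Function.update g j p)).det *
          (A.submatrix (f ∘ a.succAbove) (g ∘ i.succAbove)).det -
        (A.submatrix f (Function.update g i p)).det *
          (A.submatrix (f ∘ a.succAbove) (Function.update g j (g i) ∘ i.succAbove)).det) * hs

end Plucker

section QuasiPrincipal

variable {n k : ℕ}

/-- Row and column indices differing by at most one, with the pairs `(f i, g i)` separated from
one another; the corresponding minors are the quasi-principal minors of Gantmacher and Krein. -/
structure QuasiPrincipal (f g : Fin k → Fin n) : Prop where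
  left : StrictMono f
  right : StrictMono g
  le_left : ∀ i, (f i : ℕ) ≤ g i + 1
  le_right : ∀ i, (g i : ℕ) ≤ f i + 1
  lt_left : ∀ i j, i < j → f i < g j
  lt_right : ∀ i j, i < j → g i < f j

lemma QuasiPrincipal.symm {f g : Fin k → Fin n} (h : QuasiPrincipal f g) : QuasiPrincipal g f :=
  ⟨h.right, h.left, h.le_right, h.le_left, h.lt_right, h.lt_left⟩

lemma QuasiPrincipal.comp {f g : Fin k → Fin n} (h : QuasiPrincipal f g) {l : ℕ}
    {e : Fin l → Fin k} (he : StrictMono e) : QuasiPrincipal (f ∘ e) (g ∘ e) :=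
  ⟨h.left.comp he, h.right.comp he, fun _ => h.le_left _, fun _ => h.le_right _,
    fun _ _ hij => h.lt_left _ _ (he hij), fun _ _ hij => h.lt_right _ _ (he hij)⟩

lemma QuasiPrincipal.update {f g : Fin k → Fin n} (h : QuasiPrincipal f g) (j : Fin k) :
    QuasiPrincipal f (Function.update g j (f j)) := by
  have h1 := @h.left
  have h2 := @h.right
  refine ⟨h.left, fun a b hab => ?_, fun i => ?_, fun i => ?_, fun a b hab => ?_,
    fun a b hab => ?_⟩
  · have := h.lt_left a b hab
    have := h.lt_right a b hab
    have := h1 hab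
    have := h2 hab
    simp only [Function.update_apply]
    split_ifs <;> simp_all
  · have := h.le_left i
    simp only [Function.update_apply]
    split_ifs <;> simp_all
  · have := h.le_right i
    simp only [Function.update_apply]
    split_ifs <;> simp_all
  · have := h.lt_left a b hab
    have := h1 hab
    simp only [Function.update_apply]
    split_ifs <;> simp_all
  · have := h.lt_right a b hab
    have := h1 hab
    simp only [Function.update_apply]
    split_ifs <;> simp_all

lemma QuasiPrincipal.strictMono_update_neighbour {f g : Fin k → Fin n} (h : QuasiPrincipal f g)
    {i j : Fin k} (hij : ((i : ℕ) + 1 = j ∧ f j < g j) ∨ ((j : ℕ) + 1 = i ∧ g j < f j)) :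
    StrictMono (Function.update g i (f j)) := by
  intro a b hab
  have h2 := h.right hab
  simp only [Function.update_apply]
  split_ifs with ha hb hb
  · subst ha; subst hb; exact absurd hab (lt_irrefl _)
  · subst ha
    rcases hij with ⟨h3, h4⟩ | ⟨h3, h4⟩
    · refine h4.trans_le (h.right.monotone ?_)
      rw [Fin.le_def]; rw [Fin.lt_def] at hab; omega
    · refine h.lt_left _ _ ?_
      rw [Fin.lt_def] at *; omega
  · subst hb
    rcases hij with ⟨h3, h4⟩ | ⟨h3, h4⟩
    · refine h.lt_right _ _ ?_
      rw [Fin.lt_def] at *; omega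
    · refine lt_of_le_of_lt (h.right.monotone ?_) h4
      rw [Fin.le_def]; rw [Fin.lt_def] at hab; omega
  · exact h2

lemma strictMono_update_comp_succAbove {g : Fin (k + 1) → Fin n} (hg : StrictMono g)
    {i j : Fin (k + 1)} (hij : (i : ℕ) + 1 = j ∨ (j : ℕ) + 1 = i) :
    StrictMono (Function.update g j (g i) ∘ i.succAbove) := by
  intro a b hab
  have h1 : i.succAbove a < i.succAbove b := Fin.strictMono_succAbove i hab
  have h2 := Fin.succAbove_ne i a
  have h3 := Fin.succAbove_ne i b
  simp only [Function.comp, Function.update_apply]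
  have hne : (i.succAbove a : ℕ) ≠ i := fun h => h2 (Fin.ext h)
  have hne' : (i.succAbove b : ℕ) ≠ i := fun h => h3 (Fin.ext h)
  split_ifs with h4 h5 h5
  · exact absurd (h4.trans h5.symm) h1.ne
  · apply hg
    rw [h4] at h1
    rw [Fin.lt_def] at *; omega
  · apply hg
    rw [h5] at h1
    rw [Fin.lt_def] at *; omega
  · exact hg h1

lemma TotallyNonneg.det_quasiPrincipal_pos_of_neighbour {A : Matrix (Fin n) (Fin n) ℝ}
    (hA : TotallyNonneg A) {f g : Fin (k + 1) → Fin n} (h : QuasiPrincipal f g)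
    {i j : Fin (k + 1)} (hij : ((i : ℕ) + 1 = j ∧ f j < g j) ∨ ((j : ℕ) + 1 = i ∧ g j < f j))
    (h1 : 0 < (A.submatrix f (Function.update g j (f j))).det)
    (h2 : 0 < (A.submatrix (f ∘ i.succAbove) (g ∘ i.succAbove)).det) :
    0 < (A.submatrix f g).det := by
  have hadj : (i : ℕ) + 1 = j ∨ (j : ℕ) + 1 = i := hij.imp And.left And.left
  have hne : i ≠ j := by rintro rfl; omega
  have key := det_mul_det_minor A f g hne (f j) i
  have h3 := hA _ _ _ h.left (h.strictMono_update_neighbour hij)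
  have h4 := hA _ _ _ (h.left.comp (Fin.strictMono_succAbove i))
    (strictMono_update_comp_succAbove h.right hadj)
  refine lt_of_le_of_ne (hA _ _ _ h.left h.right) fun h0 => ?_
  rw [← h0, zero_mul] at key
  exact absurd key (add_pos_of_pos_of_nonneg (mul_pos h1 h2) (mul_nonneg h3 h4)).ne

lemma card_filter_update_lt {f g : Fin k → Fin n} {j : Fin k} (hj : f j ≠ g j) :
    #{i | f i ≠ Function.update g j (f j) i} < #{i | f i ≠ g i} := by
  apply Finset.card_lt_card
  rw [Finset.ssubset_iff_of_subset]
  · exact ⟨j, by simpa using hj, by simp⟩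
  · intro i
    simp only [Finset.mem_filter, Finset.mem_univ, true_and, Function.update_apply]
    split_ifs with hi
    · subst hi; simp
    · exact id

lemma TotallyNonneg.det_quasiPrincipal_pos {A : Matrix (Fin n) (Fin n) ℝ}
    (hA : TotallyNonneg A) (hdet : A.det ≠ 0)
    (hoff : ∀ i j : Fin n, (i : ℕ) + 1 = j → 0 < A i j ∧ 0 < A j i) {f g : Fin k → Fin n}
    (h : QuasiPrincipal f g) : 0 < (A.submatrix f g).det := by
  induction k generalizing A with
  | zero => simp
  | succ k ihk =>
    induction hd : #{i | f i ≠ g i} using Nat.strong_induction_on generalizing A f g with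
    | _ d ihd =>
      subst hd
      by_cases hfg : f = g
      · subst hfg
        exact hA.det_principal_pos hdet h.left
      obtain ⟨j, hj⟩ : ∃ j, f j ≠ g j := by
        by_contra! hall
        exact hfg (funext hall)
      have hAT := hA.transpose
      have hdetT : Aᵀ.det ≠ 0 := by rwa [Matrix.det_transpose]
      have hoffT : ∀ i j : Fin n, (i : ℕ) + 1 = j → 0 < Aᵀ i j ∧ 0 < Aᵀ j i :=
        fun i j hij => (hoff i j hij).symm
      have step : ∀ i : Fin (k + 1),
          (((i : ℕ) + 1 = j ∧ f j < g j) ∨ ((j : ℕ) + 1 = i ∧ g j < f j)) →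
          0 < (A.submatrix f g).det := fun i hi =>
        hA.det_quasiPrincipal_pos_of_neighbour h hi
          (ihd _ (card_filter_update_lt hj) hA hdet hoff (h.update j) rfl)
          (ihk hA hdet hoff (h.comp (Fin.strictMono_succAbove i)))
      have stepT : ∀ i : Fin (k + 1),
          (((i : ℕ) + 1 = j ∧ g j < f j) ∨ ((j : ℕ) + 1 = i ∧ f j < g j)) →
          0 < (A.submatrix f g).det := by
        intro i hi
        rw [← Matrix.det_transpose, Matrix.transpose_submatrix]
        refine hAT.det_quasiPrincipal_pos_of_neighbour h.symm hi
          (ihd _ ?_ hAT hdetT hoffT (h.symm.update j) rfl)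
          (ihk hAT hdetT hoffT (h.symm.comp (Fin.strictMono_succAbove i)))
        simpa only [ne_comm] using card_filter_update_lt (f := g) (g := f) hj.symm
      rcases k with _ | k
      · obtain rfl : j = 0 := Fin.ext (by omega)
        have hval : (f 0 : ℕ) ≠ g 0 := fun e => hj (Fin.ext e)
        have h1 := h.le_left 0
        have h2 := h.le_right 0
        rw [Matrix.det_fin_one]
        rcases lt_or_gt_of_ne hval with h3 | h3
        · exact (hoff (f 0) (g 0) (by omega)).1
        · exact (hoff (g 0) (f 0) (by omega)).2
      · rcases eq_or_ne (j : ℕ) 0 with hj0 | hj0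
        · rcases lt_or_gt_of_ne hj with h3 | h3
          · exact stepT 1 (Or.inr ⟨by simp [hj0], h3⟩)
          · exact step 1 (Or.inr ⟨by simp [hj0], h3⟩)
        · have hi : ((⟨j - 1, by omega⟩ : Fin (k + 2)) : ℕ) + 1 = j := by
            simp only; omega
          rcases lt_or_gt_of_ne hj with h3 | h3
          · exact step _ (Or.inl ⟨hi, h3⟩)
          · exact stepT _ (Or.inl ⟨hi, h3⟩)

end QuasiPrincipal

section Powers

variable {n k : ℕ}

lemma StrictMono.fin_val_add_le {f : Fin k → Fin n} (hf : StrictMono f) (i : Fin k) :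
    ∀ d : ℕ, ∀ h : (i : ℕ) + d < k, (f i : ℕ) + d ≤ f ⟨i + d, h⟩ := by
  intro d
  induction d with
  | zero => intro h; rfl
  | succ d ih =>
    intro h
    have h1 := ih (by omega)
    have h2 : f ⟨i + d, by omega⟩ < f ⟨i + (d + 1), h⟩ := hf (by simp [Fin.lt_def])
    rw [Fin.lt_def] at h2
    omega

lemma StrictMono.fin_le_val {f : Fin k → Fin n} (hf : StrictMono f) (i : Fin k) :
    (i : ℕ) ≤ f i := by
  have h := hf.fin_val_add_le ⟨0, i.pos⟩ i (by simp)
  simp only [zero_add] at h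
  exact (Nat.le_add_left _ _).trans h

lemma StrictMono.fin_val_add_lt {f : Fin k → Fin n} (hf : StrictMono f) (i : Fin k) :
    (f i : ℕ) + (k - 1 - i) < n := by
  have h := hf.fin_val_add_le i (k - 1 - i) (by omega)
  exact h.trans_lt (Fin.is_lt _)

/-- A path of index sets from `f` to `g`: the elements moving right start one after another from
the right, the elements moving left start one after another from the left, and every element moves
by unit steps until it reaches its target. -/
def indexPath (f g : Fin k → Fin n) (t : ℕ) (j : Fin k) : Fin n :=
  if f j ≤ g j then ⟨min (g j : ℕ) (f j + (t - (k - 1 - j))), by omega⟩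
  else ⟨max (g j : ℕ) (f j - (t - j)), by omega⟩

lemma val_indexPath (f g : Fin k → Fin n) (t : ℕ) (j : Fin k) :
    (indexPath f g t j : ℕ) =
      if (f j : ℕ) ≤ g j then min (g j : ℕ) (f j + (t - (k - 1 - j)))
      else max (g j : ℕ) (f j - (t - j)) := by
  unfold indexPath
  simp only [Fin.le_def]
  split_ifs <;> rfl

lemma indexPath_zero (f g : Fin k → Fin n) : indexPath f g 0 = f := by
  ext j
  rw [val_indexPath]
  split_ifs <;> omega

lemma indexPath_of_le {f g : Fin k → Fin n} (hf : StrictMono f) (hg : StrictMono g) {t : ℕ}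
    (ht : n - 1 ≤ t) : indexPath f g t = g := by
  ext j
  have h1 := hf.fin_le_val j
  have h2 := hg.fin_le_val j
  have h3 := hf.fin_val_add_lt j
  have h4 := hg.fin_val_add_lt j
  rw [val_indexPath]
  split_ifs <;> omega

lemma quasiPrincipal_indexPath {f g : Fin k → Fin n} (hf : StrictMono f) (hg : StrictMono g)
    (t : ℕ) : QuasiPrincipal (indexPath f g t) (indexPath f g (t + 1)) := by
  have hf' : ∀ i j, i < j → (f i : ℕ) < f j := fun i j hij => hf hij
  have hg' : ∀ i j, i < j → (g i : ℕ) < g j := fun i j hij => hg hij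
  refine ⟨fun i j hij => ?_, fun i j hij => ?_, fun i => ?_, fun i => ?_, fun i j hij => ?_,
    fun i j hij => ?_⟩
  all_goals
    simp only [Fin.lt_def, val_indexPath]
    try
      have h1 := hf' i j hij
      have h2 := hg' i j hij
      rw [Fin.lt_def] at hij
    split_ifs <;> omega

lemma TotallyNonneg.det_submatrix_pow_pos {A : Matrix (Fin n) (Fin n) ℝ} (hA : TotallyNonneg A)
    {p : ℕ → Fin k → Fin n} (hp : ∀ t, StrictMono (p t))
    (hpos : ∀ t, 0 < (A.submatrix (p t) (p (t + 1))).det) (t : ℕ) :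
    0 < ((A ^ (t + 1)).submatrix (p 0) (p (t + 1))).det := by
  induction t with
  | zero => simpa using hpos 0
  | succ t ih =>
    rw [pow_succ]
    exact (hA.pow _).det_submatrix_mul_pos hA (hp _) (hp _) ih (hpos _)

lemma TotallyNonneg.totallyPos_pow {A : Matrix (Fin n) (Fin n) ℝ} (hA : TotallyNonneg A)
    (hdet : A.det ≠ 0) (hoff : ∀ i j : Fin n, (i : ℕ) + 1 = j → 0 < A i j ∧ 0 < A j i) {m : ℕ}
    (hm : 0 < m) (hnm : n - 1 ≤ m) : TotallyPos (A ^ m) := by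
  intro k f g hf hg
  have h := hA.det_submatrix_pow_pos (fun t => (quasiPrincipal_indexPath hf hg t).left)
    (fun t => hA.det_quasiPrincipal_pos hdet hoff (quasiPrincipal_indexPath hf hg t)) (m - 1)
  rwa [Nat.sub_add_cancel hm, indexPath_zero, indexPath_of_le hf hg hnm] at h

lemma TotallyPos.apply_pos {A : Matrix (Fin n) (Fin n) ℝ} (hA : TotallyPos A) (i j : Fin n) :
    0 < A i j := by
  simpa using hA 1 (fun _ => i) (fun _ => j) (Subsingleton.strictMono _) (Subsingleton.strictMono _)

lemma Oscillatory.transpose {A : Matrix (Fin n) (Fin n) ℝ} (hA : Oscillatory A) :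
    Oscillatory Aᵀ := by
  obtain ⟨m, hm, h⟩ := hA
  refine ⟨m, hm, fun k f g hf hg => ?_⟩
  rw [← Matrix.transpose_pow, ← Matrix.det_transpose]
  exact h k g f hg hf

lemma pow_apply_eq_zero_of_block {A : Matrix (Fin n) (Fin n) ℝ} {i : Fin n}
    (hA : ∀ k l, k ≤ i → i < l → A k l = 0) (m : ℕ) {k l : Fin n} (hk : k ≤ i) (hl : i < l) :
    (A ^ m) k l = 0 := by
  induction m generalizing k l with
  | zero => exact Matrix.one_apply_ne (hk.trans_lt hl).ne
  | succ m ih =>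
    rw [pow_succ, Matrix.mul_apply]
    refine Finset.sum_eq_zero fun c _ => ?_
    rcases le_or_gt c i with h | h
    · rw [hA c l h hl, mul_zero]
    · rw [ih hk h, zero_mul]

lemma Oscillatory.superdiagonal_pos {A : Matrix (Fin n) (Fin n) ℝ} (h : Oscillatory A)
    (hA : TotallyNonneg A) (hdet : A.det ≠ 0) {i j : Fin n} (hij : (i : ℕ) + 1 = j) :
    0 < A i j := by
  have hdiag : ∀ a, 0 < A a a := fun a => by
    simpa using hA.det_principal_pos hdet (f := fun _ : Fin 1 => a) (Subsingleton.strictMono _)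
  refine lt_of_le_of_ne (hA.apply_nonneg i j) fun h0 => ?_
  have hlt : i < j := by rw [Fin.lt_def]; omega
  have hcol : ∀ a, a ≤ i → A a j = 0 := by
    intro a ha
    rcases ha.eq_or_lt with rfl | ha
    · exact h0.symm
    · have h1 := hA.mul_le_mul ha hlt
      rw [← h0, mul_zero] at h1
      have h2 := hA.apply_nonneg a j
      have h3 := hdiag i
      nlinarith
  have hblock : ∀ a b, a ≤ i → i < b → A a b = 0 := by
    intro a b ha hb
    have hjb : j ≤ b := by rw [Fin.le_def]; rw [Fin.lt_def] at hb; omega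
    rcases hjb.eq_or_lt with rfl | hjb
    · exact hcol a ha
    · have h1 := hA.mul_le_mul (ha.trans_lt hlt) hjb
      rw [hcol a ha, zero_mul] at h1
      have h2 := hA.apply_nonneg a b
      have h3 := hdiag j
      nlinarith
  obtain ⟨m, -, hm⟩ := h
  exact (hm.apply_pos i j).ne' (pow_apply_eq_zero_of_block hblock m le_rfl hlt)

/-- The Gantmacher–Krein theorem. -/
lemma Oscillatory.totallyPos_pow {A : Matrix (Fin n) (Fin n) ℝ} (h : Oscillatory A)
    (hA : TotallyNonneg A) (hdet : A.det ≠ 0) {m : ℕ} (hm : 0 < m) (hnm : n - 1 ≤ m) :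
    TotallyPos (A ^ m) :=
  hA.totallyPos_pow hdet (fun _ _ hij => ⟨h.superdiagonal_pos hA hdet hij,
    h.transpose.superdiagonal_pos hA.transpose (by rwa [Matrix.det_transpose]) hij⟩) hm hnm

lemma pow_apply_eq_zero_of_band {A : Matrix (Fin n) (Fin n) ℝ}
    (hA : ∀ i j : Fin n, (i : ℕ) + 1 < j → A i j = 0) (m : ℕ) {i j : Fin n}
    (hij : (i : ℕ) + m < j) : (A ^ m) i j = 0 := by
  induction m generalizing i j with
  | zero => exact Matrix.one_apply_ne (by rintro rfl; omega)
  | succ m ih =>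
    rw [pow_succ, Matrix.mul_apply]
    refine Finset.sum_eq_zero fun c _ => ?_
    rcases lt_or_ge ((i : ℕ) + m) c with h | h
    · rw [ih h, zero_mul]
    · rw [hA c j (by omega), mul_zero]

lemma exists_totallyNonneg_tridiagonal (n : ℕ) : ∃ A : Matrix (Fin n) (Fin n) ℝ,
    TotallyNonneg A ∧ A.det = 1 ∧ (∀ i j : Fin n, (i : ℕ) + 1 = j → 0 < A i j ∧ 0 < A j i) ∧
      ∀ i j : Fin n, (i : ℕ) + 1 < j → A i j = 0 := by
  set L : Matrix (Fin n) (Fin n) ℝ :=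
    Matrix.of fun i j => if (i : ℕ) = j ∨ (i : ℕ) = j + 1 then 1 else 0 with hL
  have h0 : ∀ i j, 0 ≤ L i j := by
    intro i j
    simp only [hL, Matrix.of_apply]
    split_ifs <;> norm_num
  have hlower : ∀ i j, i < j → L i j = 0 := by
    intro i j h
    rw [Fin.lt_def] at h
    simp only [hL, Matrix.of_apply]
    exact if_neg (by omega)
  have hband : ∀ i j : Fin n, (j : ℕ) + 1 < i → L i j = 0 := by
    intro i j h
    simp only [hL, Matrix.of_apply]
    exact if_neg (by omega)
  have hLT := totallyNonneg_of_bidiagonal h0 hlower hband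
  have hdet : L.det = 1 := by
    rw [Matrix.det_of_isLowerTriangular L fun i j h => hlower i j h]
    simp [hL]
  have hoff : ∀ i j : Fin n, (i : ℕ) + 1 = j → 0 < (L * Lᵀ) i j := by
    intro i j hij
    rw [Matrix.mul_apply]
    have h1 : L i i * Lᵀ i j = 1 := by simp [hL, hij]
    have h2 := Finset.single_le_sum (f := fun c => L i c * Lᵀ c j)
      (fun c _ => mul_nonneg (h0 i c) (h0 j c)) (Finset.mem_univ i)
    linarith
  refine ⟨L * Lᵀ, hLT.mul hLT.transpose, by simp [hdet], fun i j hij => ⟨hoff i j hij, ?_⟩,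
    fun i j hij => ?_⟩
  · have hsymm : (L * Lᵀ) j i = (L * Lᵀ) i j := by
      simp only [Matrix.mul_apply, Matrix.transpose_apply, mul_comm]
    exact hsymm ▸ hoff i j hij
  · rw [Matrix.mul_apply]
    refine Finset.sum_eq_zero fun c _ => ?_
    rcases lt_or_ge i c with h | h
    · rw [hlower i c h, zero_mul]
    · rw [Fin.le_def] at h
      rw [Matrix.transpose_apply, hband j c (by omega), mul_zero]

theorem oscillatory_iff_totallyPos_pow_iff (hn : 2 ≤ n) {m : ℕ} (hm : 0 < m) :
    (∀ x : Matrix (Fin n) (Fin n) ℝ, IsUnit x → TotallyNonneg x →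
        (Oscillatory x ↔ TotallyPos (x ^ m))) ↔ n - 1 ≤ m := by
  constructor
  · intro h
    by_contra! hmn
    obtain ⟨A, hA, hdet, hoff, hband⟩ := exists_totallyNonneg_tridiagonal n
    have hosc : Oscillatory A :=
      ⟨n - 1, by omega, hA.totallyPos_pow (by simp [hdet]) hoff (by omega) le_rfl⟩
    have hpos := (h A ((Matrix.isUnit_iff_isUnit_det A).2 (by simp [hdet])) hA).1 hosc
    exact (hpos.apply_pos ⟨0, by omega⟩ ⟨n - 1, by omega⟩).ne'
      (pow_apply_eq_zero_of_band hband m (by simpa using hmn))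
  · intro hmn x hx hT
    exact ⟨fun h => h.totallyPos_pow hT ((Matrix.isUnit_iff_isUnit_det x).1 hx).ne_zero hm hmn,
      fun h => ⟨m, hm, h⟩⟩

end Powers

section Words

variable {n : ℕ}

lemma val_adjTransposition (a : Fin (n - 1)) (y : Fin n) :
    (adjTransposition n a y : ℕ) =
      if (y : ℕ) = a then (a : ℕ) + 1 else if (y : ℕ) = a + 1 then (a : ℕ) else y := by
  simp only [adjTransposition, Equiv.swap_apply_def, Fin.ext_iff]
  split_ifs <;> rfl

lemma prod_adjTransposition_le_succ {l : List (Fin (n - 1))} (hl : l.Pairwise (· < ·))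
    (x : Fin n) : ((l.map (adjTransposition n)).prod x : ℕ) ≤ x + 1 ∧
      ((∀ a ∈ l, (x : ℕ) < a) → (l.map (adjTransposition n)).prod x = x) := by
  induction l with
  | nil => simp
  | cons a l ih =>
    rw [List.pairwise_cons] at hl
    obtain ⟨h1, h2⟩ := ih hl.2
    simp only [List.map_cons, List.prod_cons, Equiv.Perm.mul_apply]
    constructor
    · rw [val_adjTransposition]
      by_cases hx : (x : ℕ) < a
      · rw [h2 fun b hb => hx.trans (hl.1 b hb)]
        split_ifs <;> omega
      · split_ifs <;> omega
    · intro h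
      rw [h2 fun b hb => h b (List.mem_cons_of_mem _ hb)]
      have := h a List.mem_cons_self
      ext
      rw [val_adjTransposition]
      split_ifs <;> omega

lemma prod_adjTransposition_le_add {W : List (Fin (n - 1))} (hW : W.Pairwise (· < ·)) (m : ℕ)
    {l : List (Fin (n - 1))} (hl : l.Sublist (List.replicate m W).flatten) (x : Fin n) :
    ((l.map (adjTransposition n)).prod x : ℕ) ≤ x + m := by
  induction m generalizing l with
  | zero => simp_all
  | succ m ih =>
    rw [List.replicate_succ, List.flatten_cons, List.sublist_append_iff] at hl
    obtain ⟨l₁, l₂, rfl, h1, h2⟩ := hl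
    rw [List.map_append, List.prod_append, Equiv.Perm.mul_apply]
    have h3 := ih h2
    have h4 := (prod_adjTransposition_le_succ (hW.sublist h1)
      ((l₂.map (adjTransposition n)).prod x)).1
    omega

/-- The number of inversions of a permutation. -/
def inversionCount (w : Equiv.Perm (Fin n)) : ℕ :=
  #{p : Fin n × Fin n | p.1 < p.2 ∧ w p.2 < w p.1}

lemma inversionCount_one : inversionCount (1 : Equiv.Perm (Fin n)) = 0 := by
  rw [inversionCount, Finset.card_eq_zero, Finset.filter_eq_empty_iff]
  rintro ⟨x, y⟩ - ⟨h1, h2⟩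
  exact lt_asymm h1 h2

lemma inversionCount_revPerm :
    inversionCount (Fin.revPerm : Equiv.Perm (Fin n)) = n * (n - 1) / 2 := by
  have h : inversionCount (Fin.revPerm : Equiv.Perm (Fin n)) = ∑ y : Fin n, (y : ℕ) := by
    simp only [inversionCount, Fin.revPerm_apply, Fin.rev_lt_rev, and_self]
    rw [Finset.card_filter, Fintype.sum_prod_type_right]
    refine Finset.sum_congr rfl fun y _ => ?_
    rw [← Finset.card_filter, Finset.filter_gt_eq_Iio, Fin.card_Iio]
  rw [h, Fin.sum_univ_eq_sum_range (fun i => i), Finset.sum_range_id]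

/-- The position of the first of the two entries exchanged by `adjTransposition n a`. -/
def lowerIndex (a : Fin (n - 1)) : Fin n := ⟨a, by omega⟩

/-- The position of the second of the two entries exchanged by `adjTransposition n a`. -/
def upperIndex (a : Fin (n - 1)) : Fin n := ⟨a + 1, by omega⟩

lemma adjTransposition_lowerIndex (a : Fin (n - 1)) :
    adjTransposition n a (lowerIndex a) = upperIndex a :=
  Equiv.swap_apply_left _ _

lemma adjTransposition_upperIndex (a : Fin (n - 1)) :
    adjTransposition n a (upperIndex a) = lowerIndex a :=
  Equiv.swap_apply_right _ _

lemma adjTransposition_lt_iff (a : Fin (n - 1)) {x y : Fin n}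
    (h1 : ¬(x = lowerIndex a ∧ y = upperIndex a)) (h2 : ¬(x = upperIndex a ∧ y = lowerIndex a)) :
    adjTransposition n a x < adjTransposition n a y ↔ x < y := by
  simp only [lowerIndex, upperIndex, Fin.ext_iff] at h1 h2
  simp only [Fin.lt_def, val_adjTransposition]
  split_ifs <;> omega

lemma inversionCount_mul_adjTransposition {w : Equiv.Perm (Fin n)} {a : Fin (n - 1)}
    (h : w (lowerIndex a) < w (upperIndex a)) :
    inversionCount (w * adjTransposition n a) = inversionCount w + 1 := by
  set s := adjTransposition n a with hs
  have hsl : s (lowerIndex a) = upperIndex a := adjTransposition_lowerIndex a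
  have hsu : s (upperIndex a) = lowerIndex a := adjTransposition_upperIndex a
  have hlu : lowerIndex a < upperIndex a := by simp [Fin.lt_def, lowerIndex, upperIndex]
  have hsymm : s.symm = s := Equiv.symm_swap _ _
  have hset : (univ.filter fun p : Fin n × Fin n => p.1 < p.2 ∧ (w * s) p.2 < (w * s) p.1) =
      insert (lowerIndex a, upperIndex a)
        ((univ.filter fun p : Fin n × Fin n => p.1 < p.2 ∧ w p.2 < w p.1).map
          (s.prodCongr s).toEmbedding) := by
    ext ⟨x, y⟩
    rw [Finset.mem_insert, Finset.mem_map_equiv, Finset.mem_filter, Finset.mem_filter]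
    simp only [Finset.mem_univ, true_and, Equiv.prodCongr_symm, Equiv.prodCongr_apply, Prod.map,
      Equiv.Perm.mul_apply, hsymm, Prod.mk.injEq]
    by_cases h1 : x = lowerIndex a ∧ y = upperIndex a
    · obtain ⟨rfl, rfl⟩ := h1
      simp [hsl, hsu, h, hlu]
    by_cases h2 : x = upperIndex a ∧ y = lowerIndex a
    · obtain ⟨rfl, rfl⟩ := h2
      simp [hsl, hsu, h.le, hlu.ne']
    simp only [h1, false_or, hs, adjTransposition_lt_iff a h1 h2]
  rw [inversionCount, hset, Finset.card_insert_of_notMem, Finset.card_map, inversionCount]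
  simp [Finset.mem_map_equiv, Prod.map, hsymm, hsl, hsu, hlu.le]

/-- One comparator of a sorting network: put the entries at two adjacent positions into
decreasing order. -/
def sortStep (w : Equiv.Perm (Fin n)) (a : Fin (n - 1)) : Equiv.Perm (Fin n) :=
  if w (lowerIndex a) < w (upperIndex a) then w * adjTransposition n a else w

lemma exists_sublist_foldl_sortStep (W : List (Fin (n - 1))) (w : Equiv.Perm (Fin n)) :
    ∃ l : List (Fin (n - 1)), l.Sublist W ∧
      W.foldl sortStep w = w * (l.map (adjTransposition n)).prod ∧
      inversionCount (W.foldl sortStep w) = inversionCount w + l.length := by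
  induction W generalizing w with
  | nil => exact ⟨[], by simp⟩
  | cons a W ih =>
    obtain ⟨l, h1, h2, h3⟩ := ih (sortStep w a)
    by_cases h : w (lowerIndex a) < w (upperIndex a)
    · refine ⟨a :: l, h1.cons_cons a, ?_, ?_⟩
      · rw [List.foldl_cons, h2, sortStep, if_pos h, List.map_cons, List.prod_cons, mul_assoc]
      · rw [List.foldl_cons, h3, sortStep, if_pos h, inversionCount_mul_adjTransposition h,
          List.length_cons]
        omega
    · refine ⟨l, h1.cons a, ?_, ?_⟩
      · rw [List.foldl_cons, h2, sortStep, if_neg h]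
      · rw [List.foldl_cons, h3, sortStep, if_neg h]

/-- Indicator of the event that the entry at position `y` is at least `c`. -/
def largeIndicator (c : ℕ) (w : Equiv.Perm (Fin n)) (y : ℕ) : ℕ :=
  if h : y < n then (if c ≤ w ⟨y, h⟩ then 1 else 0) else 0

/-- The number of entries at the first `x` positions that are at least `c`. -/
def largeCount (c : ℕ) (w : Equiv.Perm (Fin n)) (x : ℕ) : ℕ :=
  ∑ y ∈ Finset.range x, largeIndicator c w y

lemma largeCount_succ (c : ℕ) (w : Equiv.Perm (Fin n)) (x : ℕ) :
    largeCount c w (x + 1) = largeCount c w x + largeIndicator c w x :=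
  Finset.sum_range_succ _ _

lemma largeIndicator_le_one (c : ℕ) (w : Equiv.Perm (Fin n)) (y : ℕ) :
    largeIndicator c w y ≤ 1 := by
  unfold largeIndicator
  split_ifs <;> simp

lemma largeIndicator_val (c : ℕ) (w : Equiv.Perm (Fin n)) (y : Fin n) :
    largeIndicator c w y = if c ≤ w y then 1 else 0 := by
  simp [largeIndicator]

lemma largeIndicator_mul_adjTransposition_of_ne (c : ℕ) (w : Equiv.Perm (Fin n))
    (a : Fin (n - 1)) {y : ℕ} (h1 : y ≠ a) (h2 : y ≠ a + 1) :
    largeIndicator c (w * adjTransposition n a) y = largeIndicator c w y := by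
  by_cases hy : y < n
  · have h : adjTransposition n a ⟨y, hy⟩ = ⟨y, hy⟩ := by
      ext
      simp [val_adjTransposition, h1, h2]
    simp [largeIndicator, hy, h]
  · simp [largeIndicator, hy]

lemma largeIndicator_mul_adjTransposition_left (c : ℕ) (w : Equiv.Perm (Fin n))
    (a : Fin (n - 1)) :
    largeIndicator c (w * adjTransposition n a) a = largeIndicator c w (a + 1) := by
  have h1 := largeIndicator_val c w (upperIndex a)
  have h2 := largeIndicator_val c (w * adjTransposition n a) (lowerIndex a)
  rw [Equiv.Perm.mul_apply, adjTransposition_lowerIndex] at h2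
  exact h2.trans h1.symm

lemma largeIndicator_mul_adjTransposition_right (c : ℕ) (w : Equiv.Perm (Fin n))
    (a : Fin (n - 1)) :
    largeIndicator c (w * adjTransposition n a) (a + 1) = largeIndicator c w a := by
  have h1 := largeIndicator_val c w (lowerIndex a)
  have h2 := largeIndicator_val c (w * adjTransposition n a) (upperIndex a)
  rw [Equiv.Perm.mul_apply, adjTransposition_upperIndex] at h2
  exact h2.trans h1.symm

lemma largeIndicator_le_of_apply_le {c : ℕ} {w : Equiv.Perm (Fin n)} {x y : Fin n}
    (h : w x ≤ w y) : largeIndicator c w x ≤ largeIndicator c w y := by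
  rw [largeIndicator_val, largeIndicator_val]
  have : (w x : ℕ) ≤ w y := h
  split_ifs <;> omega

lemma largeCount_mul_adjTransposition_of_ne (c : ℕ) (w : Equiv.Perm (Fin n)) (a : Fin (n - 1))
    {x : ℕ} (hx : x ≠ a + 1) :
    largeCount c (w * adjTransposition n a) x = largeCount c w x := by
  have hle : ∀ z ≤ (a : ℕ), largeCount c (w * adjTransposition n a) z = largeCount c w z :=
    fun z hz => Finset.sum_congr rfl fun y hy => by
      rw [Finset.mem_range] at hy
      exact largeIndicator_mul_adjTransposition_of_ne c w a (by omega) (by omega)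
  rcases Nat.lt_or_ge x (a + 1) with h | h
  · exact hle x (by omega)
  · have h' : (a : ℕ) + 2 ≤ x := by omega
    clear hx h
    induction x, h' using Nat.le_induction with
    | base =>
      simp only [largeCount_succ, largeIndicator_mul_adjTransposition_left,
        largeIndicator_mul_adjTransposition_right, hle a le_rfl]
      omega
    | succ x hx ih =>
      rw [largeCount_succ, largeCount_succ, ih,
        largeIndicator_mul_adjTransposition_of_ne c w a (by omega) (by omega)]

lemma largeCount_mul_adjTransposition (c : ℕ) (w : Equiv.Perm (Fin n)) (a : Fin (n - 1)) :
    largeCount c (w * adjTransposition n a) (a + 1) =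
      largeCount c w a + largeIndicator c w (a + 1) := by
  rw [largeCount_succ, largeIndicator_mul_adjTransposition_left,
    largeCount_mul_adjTransposition_of_ne c w a (by omega)]

lemma largeCount_le_sortStep (c : ℕ) (w : Equiv.Perm (Fin n)) (a : Fin (n - 1)) (x : ℕ) :
    largeCount c w x ≤ largeCount c (sortStep w a) x := by
  unfold sortStep
  split_ifs with h
  · by_cases hx : x = a + 1
    · subst hx
      rw [largeCount_mul_adjTransposition, largeCount_succ]
      exact Nat.add_le_add_left (largeIndicator_le_of_apply_le h.le) _
    · rw [largeCount_mul_adjTransposition_of_ne c w a hx]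
  · rfl

lemma min_largeCount_le_sortStep (c : ℕ) (w : Equiv.Perm (Fin n)) (a : Fin (n - 1)) :
    min (largeCount c w a + 1) (largeCount c w (a + 2)) ≤
      largeCount c (sortStep w a) (a + 1) := by
  have h1 := largeIndicator_le_one c w a
  have h2 := largeIndicator_le_one c w (a + 1)
  have h3 := largeCount_succ c w a
  have h4 : largeCount c w (a + 2) = _ := largeCount_succ c w (a + 1)
  rw [min_le_iff]
  unfold sortStep
  split_ifs with h
  · rw [largeCount_mul_adjTransposition]
    have h5 : largeIndicator c w a ≤ largeIndicator c w (a + 1) :=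
      largeIndicator_le_of_apply_le h.le
    omega
  · have h5 : largeIndicator c w (a + 1) ≤ largeIndicator c w a :=
      largeIndicator_le_of_apply_le (not_lt.mp h)
    omega

lemma largeCount_le_foldl_sortStep (c : ℕ) (W : List (Fin (n - 1))) (w : Equiv.Perm (Fin n))
    (x : ℕ) : largeCount c w x ≤ largeCount c (W.foldl sortStep w) x := by
  induction W generalizing w with
  | nil => rfl
  | cons a W ih => exact (largeCount_le_sortStep c w a x).trans (ih _)

lemma min_largeCount_le_foldl_sortStep (c : ℕ) {W : List (Fin (n - 1))}
    (w : Equiv.Perm (Fin n)) {a : Fin (n - 1)} (ha : a ∈ W) :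
    min (largeCount c w a + 1) (largeCount c w (a + 2)) ≤
      largeCount c (W.foldl sortStep w) (a + 1) := by
  obtain ⟨W₁, W₂, rfl⟩ := List.append_of_mem ha
  rw [List.foldl_append, List.foldl_cons]
  refine le_trans ?_ (largeCount_le_foldl_sortStep c W₂ _ _)
  refine le_trans ?_ (min_largeCount_le_sortStep c _ a)
  exact min_le_min (Nat.add_le_add_right (largeCount_le_foldl_sortStep c W₁ w _) 1)
    (largeCount_le_foldl_sortStep c W₁ w _)

lemma largeCount_one (c : ℕ) {x : ℕ} (hx : x ≤ n) :
    largeCount c (1 : Equiv.Perm (Fin n)) x = x - c := by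
  induction x with
  | zero => simp [largeCount]
  | succ x ih =>
    rw [largeCount_succ, ih (by omega), largeIndicator, dif_pos (by omega), Equiv.Perm.one_apply,
      Fin.val_mk]
    split_ifs <;> omega

lemma largeCount_le (c : ℕ) (w : Equiv.Perm (Fin n)) (x : ℕ) : largeCount c w x ≤ x := by
  induction x with
  | zero => simp [largeCount]
  | succ x ih =>
    rw [largeCount_succ]
    exact Nat.add_le_add ih (largeIndicator_le_one c w x)

lemma le_largeCount_foldl_sortStep {W : List (Fin (n - 1))} (hW : ∀ a, a ∈ W) (t : ℕ)
    {c j x : ℕ} (hjc : j + c ≤ n) (hjx : j ≤ x) (hxn : x ≤ n) (h : c + j ≤ x + (t + 1 - j)) :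
    j ≤ largeCount c ((List.replicate t W).flatten.foldl sortStep 1) x := by
  induction t generalizing j x with
  | zero =>
    rw [List.replicate_zero, List.flatten_nil, List.foldl_nil, largeCount_one c hxn]
    omega
  | succ t ih =>
    rcases Nat.eq_zero_or_pos j with rfl | hj
    · exact Nat.zero_le _
    by_cases h' : c + j ≤ x + (t + 1 - j)
    · rw [List.replicate_succ', List.flatten_append, List.flatten_singleton, List.foldl_append]
      exact (ih hjc hjx hxn h').trans (largeCount_le_foldl_sortStep c W _ x)
    rcases hxn.eq_or_lt with rfl | hxn'
    · refine le_trans ?_ (largeCount_le_foldl_sortStep c _ 1 x)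
      rw [largeCount_one c le_rfl]
      omega
    · have h1 := ih (j := j - 1) (x := x - 1) (by omega) (by omega) (by omega) (by omega)
      have h2 := ih (j := j) (x := x + 1) hjc (by omega) hxn' (by omega)
      rw [List.replicate_succ', List.flatten_append, List.flatten_singleton, List.foldl_append]
      have h3 := min_largeCount_le_foldl_sortStep c
        ((List.replicate t W).flatten.foldl sortStep 1) (hW ⟨x - 1, by omega⟩)
      simp only [show x - 1 + 1 = x by omega, show x - 1 + 2 = x + 1 by omega] at h3
      omega

lemma eq_revPerm_of_rev_le {w : Equiv.Perm (Fin n)} (h : ∀ y, Fin.rev y ≤ w y) :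
    w = Fin.revPerm := by
  have h1 : ∑ y : Fin n, (Fin.rev y : ℕ) = ∑ y, (w y : ℕ) :=
    (Equiv.sum_comp Fin.revPerm fun y : Fin n => (y : ℕ)).trans
      (Equiv.sum_comp w fun y : Fin n => (y : ℕ)).symm
  have h2 := (Finset.sum_eq_sum_iff_of_le fun y _ => Fin.le_def.mp (h y)).mp h1
  ext y
  exact (h2 y (Finset.mem_univ y)).symm

lemma foldl_sortStep_eq_revPerm {W : List (Fin (n - 1))} (hW : ∀ a, a ∈ W) {m : ℕ}
    (hm : n - 1 ≤ m) : (List.replicate m W).flatten.foldl sortStep 1 = Fin.revPerm := by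
  refine eq_revPerm_of_rev_le fun y => ?_
  have h1 := le_largeCount_foldl_sortStep hW m (c := n - 1 - y) (j := y + 1) (x := y + 1)
    (by omega) le_rfl (by omega) (by omega)
  set w := (List.replicate m W).flatten.foldl sortStep 1
  have h2 := largeCount_le (n - 1 - y) w y
  rw [largeCount_succ, largeIndicator_val] at h1
  rw [Fin.le_def, Fin.val_rev]
  split_ifs at h1 <;> omega

/-- Every Coxeter word repeated `m` times contains a reduced word for the longest element exactly
when `m` is at least the rank. -/
lemma forall_exists_isReducedWordW0_iff (hn : 2 ≤ n) (m : ℕ) :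
    (∀ σ : Equiv.Perm (Fin (n - 1)),
      ∃ l : List (Fin (n - 1)), IsReducedWordW0 n l ∧
        l.Sublist (List.replicate m (List.ofFn fun k => σ k)).flatten) ↔ n - 1 ≤ m := by
  constructor
  · intro h
    obtain ⟨l, ⟨h1, -⟩, h2⟩ := h 1
    have h3 := prod_adjTransposition_le_add (List.pairwise_ofFn.mpr fun i j hij => hij) m h2
      ⟨0, by omega⟩
    rw [h1, Fin.revPerm_apply, Fin.val_rev] at h3
    simp only at h3
    omega
  · intro hm σ
    have hW : ∀ a, a ∈ List.ofFn fun k => σ k := fun a =>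
      List.mem_ofFn.mpr (σ.surjective a)
    obtain ⟨l, h1, h2, h3⟩ := exists_sublist_foldl_sortStep
      (List.replicate m (List.ofFn fun k => σ k)).flatten 1
    rw [foldl_sortStep_eq_revPerm hW hm] at h2 h3
    rw [inversionCount_one, inversionCount_revPerm, zero_add] at h3
    exact ⟨l, ⟨by rw [h2, one_mul], h3.symm⟩, h1⟩

end Words

/-- A positive integer `m` satisfies "every invertible totally nonnegative `n×n` matrix
is oscillatory iff its `m`-th power is totally positive" iff for every permutation of
the letters `1,…,n-1`, the concatenation of `m` copies of it contains a reduced word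
for `w₀` as a subsequence. -/
theorem stmt10 (n : ℕ) (hn : 2 ≤ n) (m : ℕ) (hm : 0 < m) :
    (∀ x : Matrix (Fin n) (Fin n) ℝ, IsUnit x → TotallyNonneg x →
        (Oscillatory x ↔ TotallyPos (x ^ m))) ↔
    (∀ σ : Equiv.Perm (Fin (n - 1)),
        ∃ l : List (Fin (n - 1)), IsReducedWordW0 n l ∧
          l.Sublist (List.replicate m (List.ofFn fun k => σ k)).flatten) := by
  exact (oscillatory_iff_totallyPos_pow_iff hn hm).trans
    (forall_exists_isReducedWordW0_iff hn m).symm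
end

section
/- Let n ≥ 2 and set r = n−1. For every permutation (i_1, …, i_r) of the indices 1, …, r, the word obtained by concatenating r copies of (i_1, …, i_r) contains, as a (not necessarily contiguous) subsequence, a reduced word for the longest element w₀ of the symmetric group S_n. -/
/-- Right multiplication of `w` by the adjacent transposition `s_k` whenever this increases the
length. -/
def bubbleStep (n : ℕ) (w : Equiv.Perm (Fin n)) (k : Fin (n - 1)) : Equiv.Perm (Fin n) :=
  if w ⟨k.val, by have := k.isLt; omega⟩ < w ⟨k.val + 1, by have := k.isLt; omega⟩ then
    w * adjTransposition n k
  else w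

/-- The set of inversions of a permutation. -/
def inversionSet {n : ℕ} (w : Equiv.Perm (Fin n)) : Finset (Fin n × Fin n) :=
  Finset.univ.filter fun p => p.1 < p.2 ∧ w p.2 < w p.1

/-- The value of `w` at a natural number, with junk value `0` outside the domain. -/
def permVal {n : ℕ} (w : Equiv.Perm (Fin n)) (i : ℕ) : ℕ :=
  if h : i < n then (w ⟨i, h⟩).val else 0

/-- The number of `i < m` with `t ≤ w i`. -/
def prefixCount {n : ℕ} (w : Equiv.Perm (Fin n)) (t m : ℕ) : ℕ :=
  ∑ i ∈ Finset.range m, if t ≤ permVal w i then 1 else 0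

theorem prefixCount_succ {n : ℕ} (w : Equiv.Perm (Fin n)) (t m : ℕ) :
    prefixCount w t (m + 1) = prefixCount w t m + if t ≤ permVal w m then 1 else 0 :=
  Finset.sum_range_succ _ _

theorem card_inversionSet_mul_adjTransposition {n : ℕ} (w : Equiv.Perm (Fin n)) (k : Fin (n - 1))
    (h : w ⟨k.val, by have := k.isLt; omega⟩ < w ⟨k.val + 1, by have := k.isLt; omega⟩) :
    (inversionSet (w * adjTransposition n k)).card = (inversionSet w).card + 1 := by
  have hk := k.isLt
  set a : Fin n := ⟨k.val, by omega⟩ with ha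
  set b : Fin n := ⟨k.val + 1, by omega⟩ with hb
  have hs : adjTransposition n k = Equiv.swap a b := rfl
  have key : ∀ i j : Fin n, i < j → ¬ (i = a ∧ j = b) →
      Equiv.swap a b i < Equiv.swap a b j := by
    intro i j hij hne
    simp only [Equiv.swap_apply_def]
    simp only [Fin.ext_iff, Fin.lt_def, ha, hb] at *
    split_ifs <;> (try simp only) <;> omega
  have heq : inversionSet (w * adjTransposition n k) =
      insert (a, b) ((inversionSet w).map
        ((Equiv.prodCongr (Equiv.swap a b) (Equiv.swap a b)).toEmbedding)) := by
    ext ⟨i, j⟩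
    simp only [inversionSet, hs, Finset.mem_filter, Finset.mem_univ, true_and,
      Equiv.Perm.mul_apply, Finset.mem_insert, Finset.mem_map_equiv, Prod.mk.injEq,
      Equiv.prodCongr_symm, Equiv.symm_swap, Equiv.prodCongr_apply, Prod.map_apply]
    constructor
    · rintro ⟨h1, h2⟩
      by_cases hc : i = a ∧ j = b
      · exact Or.inl hc
      · exact Or.inr ⟨key i j h1 hc, h2⟩
    · rintro (⟨rfl, rfl⟩ | ⟨h1, h2⟩)
      · refine ⟨by simp [ha, hb, Fin.lt_def], ?_⟩
        simpa using h
      · refine ⟨?_, h2⟩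
        have := key _ _ h1 ?_
        · simpa using this
        · rintro ⟨h3, h4⟩
          rw [h3, h4] at h2
          exact absurd h2 (not_lt.mpr h.le)
  rw [heq, Finset.card_insert_of_notMem, Finset.card_map]
  simp only [inversionSet, Finset.mem_map_equiv, Finset.mem_filter, Finset.mem_univ, true_and,
      Equiv.prodCongr_symm, Equiv.symm_swap, Equiv.prodCongr_apply, Prod.map_apply,
      Equiv.swap_apply_left, Equiv.swap_apply_right]
  rintro ⟨h1, -⟩
  simp [ha, hb, Fin.lt_def] at h1

theorem exists_sublist_foldl_bubbleStep {n : ℕ} (L : List (Fin (n - 1)))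
    (w : Equiv.Perm (Fin n)) :
    ∃ l : List (Fin (n - 1)), l.Sublist L ∧
      L.foldl (bubbleStep n) w = w * (l.map (adjTransposition n)).prod ∧
      (inversionSet (L.foldl (bubbleStep n) w)).card = (inversionSet w).card + l.length := by
  induction L generalizing w with
  | nil => exact ⟨[], by simp⟩
  | cons k L ih =>
    obtain ⟨l, h1, h2, h3⟩ := ih (bubbleStep n w k)
    rw [List.foldl_cons]
    by_cases h : w ⟨k.val, by have := k.isLt; omega⟩ < w ⟨k.val + 1, by have := k.isLt; omega⟩
    · have hw : bubbleStep n w k = w * adjTransposition n k := if_pos h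
      refine ⟨k :: l, h1.cons_cons k, ?_, ?_⟩
      · rw [h2, hw, List.map_cons, List.prod_cons, mul_assoc]
      · rw [h3, hw, card_inversionSet_mul_adjTransposition w k h, List.length_cons]
        omega
    · have hw : bubbleStep n w k = w := if_neg h
      refine ⟨l, h1.cons k, ?_, ?_⟩
      · rw [h2, hw]
      · rw [h3, hw]

theorem permVal_bubbleStep {n : ℕ} (w : Equiv.Perm (Fin n)) (k : Fin (n - 1)) (i : ℕ) :
    permVal (bubbleStep n w k) i =
      if i = k.val then max (permVal w k.val) (permVal w (k.val + 1))
      else if i = k.val + 1 then min (permVal w k.val) (permVal w (k.val + 1))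
      else permVal w i := by
  have hk := k.isLt
  have hk0 : k.val < n := by omega
  have hk1 : k.val + 1 < n := by omega
  unfold bubbleStep
  by_cases hi : i < n
  · split_ifs with h h1 h2 h1 h2 <;> rw [Fin.lt_def] at h
    · subst h1
      simp only [permVal, hk0, hk1, dif_pos, adjTransposition, Equiv.Perm.mul_apply,
        Equiv.swap_apply_left]
      omega
    · subst h2
      simp only [permVal, hk0, hk1, dif_pos, adjTransposition, Equiv.Perm.mul_apply,
        Equiv.swap_apply_right]
      omega
    · simp only [permVal, hi, dif_pos, adjTransposition, Equiv.Perm.mul_apply]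
      rw [Equiv.swap_apply_of_ne_of_ne] <;> simpa [Fin.ext_iff]
    · subst h1
      simp only [permVal, hk0, hk1, dif_pos]
      omega
    · subst h2
      simp only [permVal, hk0, hk1, dif_pos]
      omega
  · rw [if_neg (show i ≠ k.val by omega), if_neg (show i ≠ k.val + 1 by omega)]
    simp [permVal, hi]

theorem permVal_bubbleStep_of_ne {n : ℕ} (w : Equiv.Perm (Fin n)) (k : Fin (n - 1)) {i : ℕ}
    (h0 : i ≠ k.val) (h1 : i ≠ k.val + 1) : permVal (bubbleStep n w k) i = permVal w i := by
  rw [permVal_bubbleStep, if_neg h0, if_neg h1]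

theorem prefixCount_bubbleStep_of_le {n : ℕ} (w : Equiv.Perm (Fin n)) (k : Fin (n - 1)) (t : ℕ)
    {m : ℕ} (hm : m ≤ k.val) : prefixCount (bubbleStep n w k) t m = prefixCount w t m := by
  refine Finset.sum_congr rfl fun i hi => ?_
  rw [Finset.mem_range] at hi
  rw [permVal_bubbleStep_of_ne w k (by omega) (by omega)]

theorem prefixCount_bubbleStep_of_ge {n : ℕ} (w : Equiv.Perm (Fin n)) (k : Fin (n - 1)) (t : ℕ)
    {m : ℕ} (hm : k.val + 2 ≤ m) : prefixCount (bubbleStep n w k) t m = prefixCount w t m := by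
  induction m, hm using Nat.le_induction with
  | base =>
    simp only [prefixCount_succ, prefixCount_bubbleStep_of_le w k t le_rfl, permVal_bubbleStep]
    simp only [if_true, Nat.succ_ne_self, if_false]
    split_ifs <;> omega
  | succ m hm ih =>
    rw [prefixCount_succ, prefixCount_succ, ih,
      permVal_bubbleStep_of_ne w k (by omega) (by omega)]

theorem prefixCount_bubbleStep_succ {n : ℕ} (w : Equiv.Perm (Fin n)) (k : Fin (n - 1)) (t : ℕ) :
    prefixCount (bubbleStep n w k) t (k.val + 1) =
      min (prefixCount w t k.val + 1) (prefixCount w t (k.val + 2)) := by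
  simp only [prefixCount_succ, prefixCount_bubbleStep_of_le w k t le_rfl, permVal_bubbleStep]
  simp only [if_true]
  split_ifs <;> omega

theorem prefixCount_le_bubbleStep {n : ℕ} (w : Equiv.Perm (Fin n)) (k : Fin (n - 1)) (t m : ℕ) :
    prefixCount w t m ≤ prefixCount (bubbleStep n w k) t m := by
  rcases lt_trichotomy m (k.val + 1) with h | rfl | h
  · rw [prefixCount_bubbleStep_of_le w k t (by omega)]
  · rw [prefixCount_bubbleStep_succ]
    simp only [prefixCount_succ]
    split_ifs <;> omega
  · rw [prefixCount_bubbleStep_of_ge w k t (by omega)]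

theorem prefixCount_le_foldl_bubbleStep {n : ℕ} (L : List (Fin (n - 1)))
    (w : Equiv.Perm (Fin n)) (t m : ℕ) :
    prefixCount w t m ≤ prefixCount (L.foldl (bubbleStep n) w) t m := by
  induction L generalizing w with
  | nil => exact le_rfl
  | cons k L ih => exact (prefixCount_le_bubbleStep w k t m).trans (ih _)

theorem min_le_prefixCount_foldl_bubbleStep {n : ℕ} (L : List (Fin (n - 1)))
    (w : Equiv.Perm (Fin n)) (t : ℕ) {k : Fin (n - 1)} (hk : k ∈ L) :
    min (prefixCount w t k.val + 1) (prefixCount w t (k.val + 2)) ≤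
      prefixCount (L.foldl (bubbleStep n) w) t (k.val + 1) := by
  obtain ⟨L₁, L₂, rfl⟩ := List.append_of_mem hk
  rw [List.foldl_append, List.foldl_cons]
  refine le_trans ?_ (prefixCount_le_foldl_bubbleStep L₂ _ t _)
  rw [prefixCount_bubbleStep_succ]
  exact min_le_min (Nat.succ_le_succ (prefixCount_le_foldl_bubbleStep L₁ w t _))
    (prefixCount_le_foldl_bubbleStep L₁ w t _)

theorem prefixCount_one {n : ℕ} (t m : ℕ) (hm : m ≤ n) :
    prefixCount (1 : Equiv.Perm (Fin n)) t m = m - t := by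
  induction m with
  | zero => simp [prefixCount]
  | succ m ih =>
    rw [prefixCount_succ, ih (by omega)]
    simp only [permVal, dif_pos (show m < n by omega), Equiv.Perm.one_apply]
    split_ifs <;> omega

/-- After `r` rounds of bubble sort on the identity, the `j`-th entry that is at least `t` has
position less than `m`, as soon as `j < m` and `t + 2 * j < m + r`. -/
theorem lt_prefixCount_foldl_replicate {n : ℕ} (c : List (Fin (n - 1))) (hc : ∀ k, k ∈ c)
    (r t j m : ℕ) (hjt : j + t < n) (hjm : j < m) (hm : m ≤ n) (h : t + 2 * j < m + r) :
    j < prefixCount ((List.replicate r c).flatten.foldl (bubbleStep n) 1) t m := by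
  induction r generalizing j m with
  | zero =>
    simp only [List.replicate_zero, List.flatten_nil, List.foldl_nil]
    rw [prefixCount_one t m hm]
    omega
  | succ r ih =>
    rw [List.replicate_succ', List.flatten_append, List.flatten_singleton, List.foldl_append]
    set w := (List.replicate r c).flatten.foldl (bubbleStep n) 1 with hw
    by_cases h' : t + 2 * j < m + r
    · exact (ih j m hjt hjm hm h').trans_le (prefixCount_le_foldl_bubbleStep c w t m)
    · rcases hm.eq_or_lt with rfl | hmn
      · refine lt_of_lt_of_le ?_ ((prefixCount_le_foldl_bubbleStep
          (List.replicate r c).flatten 1 t m).trans (prefixCount_le_foldl_bubbleStep c w t m))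
        rw [prefixCount_one t m le_rfl]
        omega
      · obtain ⟨k, rfl⟩ : ∃ k, m = k + 1 := ⟨m - 1, by omega⟩
        refine lt_of_lt_of_le ?_
          (min_le_prefixCount_foldl_bubbleStep c w t (hc ⟨k, by omega⟩))
        refine lt_min ?_ (ih j (k + 2) hjt (by omega) (by omega) (by omega))
        rcases Nat.eq_zero_or_pos j with rfl | hj
        · omega
        · have := ih (j - 1) k (by omega) (by omega) (by omega) (by omega)
          simp only
          omega

theorem prefixCount_le {n : ℕ} (w : Equiv.Perm (Fin n)) (t m : ℕ) : prefixCount w t m ≤ m := by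
  induction m with
  | zero => simp [prefixCount]
  | succ m ih =>
    rw [prefixCount_succ]
    split_ifs <;> omega

theorem eq_revPerm_of_forall_lt_prefixCount {n : ℕ} (w : Equiv.Perm (Fin n))
    (h : ∀ t j, j + t < n → j < prefixCount w t (j + 1)) : w = Fin.revPerm := by
  have hle : ∀ i : Fin n, (Fin.revPerm i).val ≤ (w i).val := by
    intro i
    have hi := i.isLt
    have h1 := h (n - (i.val + 1)) i.val (by omega)
    have h2 := prefixCount_le w (n - (i.val + 1)) i.val
    rw [prefixCount_succ] at h1
    simp only [permVal, dif_pos hi] at h1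
    rw [Fin.revPerm_apply, Fin.val_rev]
    by_contra hlt
    rw [if_neg hlt] at h1
    omega
  have hsum : ∑ i : Fin n, (Fin.revPerm i).val = ∑ i : Fin n, (w i).val := by
    rw [Equiv.sum_comp Fin.revPerm (fun i : Fin n => i.val),
      Equiv.sum_comp w (fun i : Fin n => i.val)]
  ext i
  exact ((Finset.sum_eq_sum_iff_of_le fun i _ => hle i).mp hsum i (Finset.mem_univ i)).symm

theorem card_inversionSet_one {n : ℕ} : (inversionSet (1 : Equiv.Perm (Fin n))).card = 0 := by
  rw [Finset.card_eq_zero, inversionSet, Finset.filter_eq_empty_iff]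
  rintro p - ⟨h1, h2⟩
  exact lt_asymm h1 h2

theorem card_inversionSet_revPerm {n : ℕ} :
    (inversionSet (Fin.revPerm : Equiv.Perm (Fin n))).card = n * (n - 1) / 2 := by
  simp only [inversionSet, Fin.revPerm_apply, Fin.rev_lt_rev, and_self]
  rw [Finset.card_filter, Fintype.sum_prod_type_right]
  simp only [← Finset.card_filter]
  rw [← Finset.sum_range_id, ← Fin.sum_univ_eq_sum_range (fun i => i) n]
  refine Finset.sum_congr rfl fun j _ => ?_
  rw [← Fin.card_Iio j]
  congr 1
  ext i
  simp

/-- For every permutation of the letters `1,…,n-1`, the concatenation of `n-1` copies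
of it contains a reduced word for the longest element `w₀` of `S_n` as a subsequence. -/
theorem stmt11 (n : ℕ) (hn : 2 ≤ n) (σ : Equiv.Perm (Fin (n - 1))) :
    ∃ l : List (Fin (n - 1)), IsReducedWordW0 n l ∧
      l.Sublist (List.replicate (n - 1) (List.ofFn fun k => σ k)).flatten := by
  have hc : ∀ k, k ∈ List.ofFn fun k => σ k := fun k =>
    List.mem_ofFn.mpr ⟨σ.symm k, σ.apply_symm_apply k⟩
  obtain ⟨l, hl, hprod, hcard⟩ := exists_sublist_foldl_bubbleStep
    (List.replicate (n - 1) (List.ofFn fun k => σ k)).flatten 1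
  have hrev := eq_revPerm_of_forall_lt_prefixCount _ fun t j hjt =>
    lt_prefixCount_foldl_replicate _ hc (n - 1) t j (j + 1) hjt (by omega) (by omega) (by omega)
  rw [hrev, one_mul] at hprod
  rw [hrev, card_inversionSet_revPerm, card_inversionSet_one, zero_add] at hcard
  exact ⟨l, ⟨hprod.symm, hcard.symm⟩, hl⟩
end
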